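/- arXiv:1207.0430 — 3 statements merged into one kernel-verified Lean document; each statement's English description precedes it below -/
import Mathlib

section
/- For all positive integers m, n and every real number t with t ≠ 1, the power sum ∑_{i=1}^m i^n t^i equals ∑_{l=1}^{n} (-1)^{n+l} C(n, l) t^{m+1} m^l A_{n-l}(t) / (t-1)^{n-l+1} + (-1)^n t (t^m - 1) A_n(t) / (t-1)^{n+1}, where C denotes the binomial coefficient. -/
open scoped Classical

/-- Number of ascents of a permutation of `Fin n`:
positions `j` with `j + 1 < n` and `π j < π (j+1)`. -/
noncomputable def ascentCount {n : ℕ} (π : Equiv.Perm (Fin n)) : ℕ :=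
  ((Finset.range (n - 1)).filter (fun j =>
    ∃ h : j + 1 < n, π ⟨j, Nat.lt_of_succ_lt h⟩ < π ⟨j + 1, h⟩)).card

/-- The Eulerian number `A_{n,k}`: the number of permutations of an `n`-element
linearly ordered set with exactly `k` ascents. -/
noncomputable def eulerian (n k : ℕ) : ℕ :=
  (Finset.univ.filter (fun π : Equiv.Perm (Fin n) => ascentCount π = k)).card

/-- The `n`-th Eulerian polynomial `A_n(t) = ∑_{k=0}^{n-1} A_{n,k} t^k`, with `A_0(t) = 1`. -/
noncomputable def eulerianPoly (n : ℕ) (t : ℝ) : ℝ :=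
  if n = 0 then 1 else ∑ k ∈ Finset.range n, (eulerian n k : ℝ) * t ^ k

/-- The permutation obtained from `σ` by inserting a new maximum at position `p`. -/
def insertMax {n : ℕ} (p : Fin (n + 1)) (σ : Equiv.Perm (Fin n)) : Equiv.Perm (Fin (n + 1)) :=
  ((finSuccEquiv' p).trans (Equiv.optionCongr σ)).trans (finSuccEquiv' (Fin.last n)).symm

lemma insertMax_self {n : ℕ} (p : Fin (n + 1)) (σ : Equiv.Perm (Fin n)) :
    insertMax p σ p = Fin.last n := by
  simp [insertMax]

lemma insertMax_succAbove {n : ℕ} (p : Fin (n + 1)) (σ : Equiv.Perm (Fin n)) (j : Fin n) :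
    insertMax p σ (p.succAbove j) = (σ j).castSucc := by
  simp [insertMax]

lemma insertMax_bijective (n : ℕ) :
    Function.Bijective
      (fun x : Fin (n + 1) × Equiv.Perm (Fin n) => insertMax x.1 x.2) := by
  rw [Fintype.bijective_iff_injective_and_card]
  refine ⟨?_, by simp [Fintype.card_perm, Nat.factorial_succ]⟩
  rintro ⟨p, σ⟩ ⟨q, τ⟩ h
  simp only at h
  obtain rfl : p = q := by
    apply (insertMax q τ).injective
    rw [insertMax_self, ← h, insertMax_self]
  congr 1
  ext j
  have := insertMax_succAbove p σ j
  rw [h, insertMax_succAbove] at this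
  exact (congrArg Fin.val (Fin.castSucc_injective _ this)).symm

lemma ascentCount_eq_sum {n : ℕ} (π : Equiv.Perm (Fin (n + 1))) :
    ascentCount π = ∑ j : Fin n, if π j.castSucc < π j.succ then 1 else 0 := by
  rw [ascentCount, Finset.card_filter, Nat.add_sub_cancel, Finset.sum_range]
  refine Finset.sum_congr rfl fun j _ => ?_
  have hj : (j : ℕ) + 1 < n + 1 := by omega
  simp only [hj, exists_true_left]
  rfl

lemma ascentCount_insertMax_zero {n : ℕ} (σ : Equiv.Perm (Fin (n + 1))) :
    ascentCount (insertMax 0 σ) = ascentCount σ := by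
  have h (j : Fin (n + 1)) : insertMax 0 σ j.succ = (σ j).castSucc := by
    simpa using insertMax_succAbove 0 σ j
  rw [ascentCount_eq_sum, ascentCount_eq_sum, Fin.sum_univ_succ]
  simp only [Fin.castSucc_zero, insertMax_self, ← Fin.succ_castSucc, h, Fin.castSucc_lt_castSucc_iff]
  simp [Fin.le_last]

lemma ascentCount_insertMax_last {n : ℕ} (σ : Equiv.Perm (Fin (n + 1))) :
    ascentCount (insertMax (Fin.last _) σ) = ascentCount σ + 1 := by
  have h (j : Fin (n + 1)) : insertMax (Fin.last _) σ j.castSucc = (σ j).castSucc := by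
    simpa using insertMax_succAbove (Fin.last _) σ j
  rw [ascentCount_eq_sum, ascentCount_eq_sum, Fin.sum_univ_castSucc]
  simp only [Fin.succ_last, insertMax_self, Fin.succ_castSucc, h, Fin.castSucc_lt_castSucc_iff]
  simp [Fin.castSucc_lt_last]

lemma ascentCount_insertMax_succ_castSucc {n : ℕ} (σ : Equiv.Perm (Fin (n + 1))) (k : Fin n) :
    ascentCount (insertMax k.succ.castSucc σ) +
      (if σ k.castSucc < σ k.succ then 1 else 0) = ascentCount σ + 1 := by
  have hlt (j : Fin (n + 1)) (hj : j < k.succ) :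
      insertMax k.succ.castSucc σ j.castSucc = (σ j).castSucc := by
    rw [← insertMax_succAbove k.succ.castSucc σ j, Fin.succAbove_of_castSucc_lt]
    exact Fin.castSucc_lt_castSucc_iff.2 hj
  have hge (j : Fin (n + 1)) (hj : k.succ ≤ j) :
      insertMax k.succ.castSucc σ j.succ = (σ j).castSucc := by
    rw [← insertMax_succAbove k.succ.castSucc σ j, Fin.succAbove_of_le_castSucc]
    exact Fin.castSucc_le_castSucc_iff.2 hj
  rw [ascentCount_eq_sum, ascentCount_eq_sum, Fin.sum_univ_succAbove _ k.castSucc]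
  have hk : insertMax k.succ.castSucc σ k.castSucc.castSucc = (σ k.castSucc).castSucc :=
    hlt _ Fin.castSucc_lt_succ
  have hrest (i : Fin n) :
      (if insertMax k.succ.castSucc σ (k.castSucc.succAbove i).castSucc <
          insertMax k.succ.castSucc σ (k.castSucc.succAbove i).succ then 1 else 0) =
        if i = k then 0 else if σ i.castSucc < σ i.succ then 1 else 0 := by
    rcases lt_trichotomy i k with hik | rfl | hik
    · have hik' := Fin.lt_def.1 hik
      rw [Fin.succAbove_of_castSucc_lt _ _ (by simpa using hik), Fin.succ_castSucc,
        hlt _ (Fin.lt_def.2 (by simp only [Fin.val_castSucc, Fin.val_succ]; omega)),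
        hlt _ (Fin.succ_lt_succ_iff.2 hik)]
      simp [hik.ne]
    · rw [Fin.succAbove_of_le_castSucc _ _ le_rfl, insertMax_self]
      simp [Fin.le_last]
    · have hik' := Fin.lt_def.1 hik
      rw [Fin.succAbove_of_le_castSucc _ _ (by simpa using hik.le), ← Fin.succ_castSucc i,
        hge _ (Fin.le_def.2 (by simp only [Fin.val_castSucc, Fin.val_succ]; omega)),
        hge _ (Fin.succ_le_succ_iff.2 hik.le)]
      simp [hik.ne']
  rw [Finset.sum_congr rfl fun i _ => hrest i, hk, Fin.succ_castSucc, insertMax_self,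
    if_pos (Fin.castSucc_lt_last _),
    ← Finset.add_sum_erase _ (fun i : Fin n => if σ i.castSucc < σ i.succ then 1 else 0)
      (Finset.mem_univ k),
    ← Finset.add_sum_erase _ (fun i : Fin n => if i = k then 0 else
      if σ i.castSucc < σ i.succ then 1 else 0) (Finset.mem_univ k),
    Finset.sum_congr rfl fun i hi => if_neg (Finset.ne_of_mem_erase hi)]
  simp only [if_true]
  omega

lemma ascentCount_lt {n : ℕ} (hn : n ≠ 0) (π : Equiv.Perm (Fin n)) : ascentCount π < n := by
  have := Finset.card_filter_le (Finset.range (n - 1)) (fun j =>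
    ∃ h : j + 1 < n, π ⟨j, Nat.lt_of_succ_lt h⟩ < π ⟨j + 1, h⟩)
  rw [Finset.card_range] at this
  unfold ascentCount
  omega

lemma eulerianPoly_eq_sum_perm (n : ℕ) (t : ℝ) :
    eulerianPoly n t = ∑ π : Equiv.Perm (Fin n), t ^ ascentCount π := by
  rcases eq_or_ne n 0 with rfl | hn
  · simp [eulerianPoly, ascentCount]
  · rw [eulerianPoly, if_neg hn, ← Finset.sum_fiberwise_of_maps_to
      (g := fun π : Equiv.Perm (Fin n) => ascentCount π) (t := Finset.range n)
      (fun π _ => Finset.mem_range.2 (ascentCount_lt hn π))]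
    refine Finset.sum_congr rfl fun k _ => ?_
    rw [Finset.sum_congr rfl fun π hπ => by rw [(Finset.mem_filter.1 hπ).2],
      Finset.sum_const, nsmul_eq_mul, eulerian]

lemma sum_pow_ascentCount_insertMax {n : ℕ} (σ : Equiv.Perm (Fin (n + 1))) (t : ℝ) :
    ∑ p, t ^ ascentCount (insertMax p σ) =
      (1 + ((n + 1 : ℕ) : ℝ) * t) * t ^ ascentCount σ +
        (1 - t) * (ascentCount σ * t ^ ascentCount σ) := by
  have hmid (k : Fin n) : t ^ ascentCount (insertMax k.castSucc.succ σ) =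
      t ^ ascentCount σ * (t + (1 - t) * if σ k.castSucc < σ k.succ then 1 else 0) := by
    have := ascentCount_insertMax_succ_castSucc σ k
    rw [Fin.succ_castSucc]
    split_ifs at this ⊢
    · rw [Nat.add_right_cancel this]; ring
    · rw [← add_zero (ascentCount (insertMax _ _)), this]; ring
  have hcast : (ascentCount σ : ℝ) = ∑ j : Fin n, if σ j.castSucc < σ j.succ then 1 else 0 := by
    rw [ascentCount_eq_sum]; push_cast; rfl
  rw [Fin.sum_univ_succ, Fin.sum_univ_castSucc, Fin.succ_last, ascentCount_insertMax_zero,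
    ascentCount_insertMax_last, Finset.sum_congr rfl fun k _ => hmid k, ← Finset.mul_sum,
    Finset.sum_add_distrib, ← Finset.mul_sum, ← hcast]
  simp
  ring

/-- The differential recurrence `A_{n+1} = (1 + n t) A_n + t (1 - t) dA_n/dt`. -/
lemma exists_hasDerivAt_eulerianPoly (n : ℕ) (t : ℝ) :
    ∃ d, HasDerivAt (eulerianPoly n) d t ∧
      eulerianPoly (n + 1) t = (1 + n * t) * eulerianPoly n t + (1 - t) * (t * d) := by
  refine ⟨∑ π : Equiv.Perm (Fin n), ascentCount π * t ^ (ascentCount π - 1), ?_, ?_⟩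
  · rw [funext (eulerianPoly_eq_sum_perm n)]
    exact HasDerivAt.fun_sum fun π _ => hasDerivAt_pow _ t
  · rcases n with _ | n
    · simp [eulerianPoly_eq_sum_perm, ascentCount]
    · rw [eulerianPoly_eq_sum_perm,
        ← (insertMax_bijective (n + 1)).sum_comp (fun π => t ^ ascentCount π),
        Fintype.sum_prod_type_right]
      simp only [sum_pow_ascentCount_insertMax]
      rw [Finset.sum_add_distrib, ← Finset.mul_sum, ← Finset.mul_sum,
        ← eulerianPoly_eq_sum_perm, Finset.mul_sum _ _ t]
      congr 2
      refine Fintype.sum_congr _ _ fun π => ?_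
      rcases ascentCount π with _ | a
      · simp
      · rw [Nat.add_sub_cancel]; ring

/-- The normalized Eulerian function `(-1)^n A_n(t) / (t - 1)^(n + 1)`. -/
noncomputable def eulerianRatio (n : ℕ) (t : ℝ) : ℝ :=
  (-1) ^ n * eulerianPoly n t / (t - 1) ^ (n + 1)

lemma hasDerivAt_pow_mul_eulerianRatio (m n : ℕ) {t : ℝ} (ht : t ≠ 1) :
    ∃ d, HasDerivAt (fun s => s ^ (m + 1) * eulerianRatio n s) d t ∧
      t * d = t ^ (m + 1) * (m * eulerianRatio n t + eulerianRatio (n + 1) t) := by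
  obtain ⟨d, hd, hrec⟩ := exists_hasDerivAt_eulerianPoly n t
  have h1 : t - 1 ≠ 0 := sub_ne_zero.2 ht
  have hden : HasDerivAt (fun s : ℝ => (s - 1) ^ (n + 1)) (((n + 1 : ℕ) : ℝ) * (t - 1) ^ n) t := by
    simpa using ((hasDerivAt_id t).sub_const 1).fun_pow (n + 1)
  refine ⟨_, (hasDerivAt_pow (m + 1) t).mul
    ((hd.const_mul ((-1) ^ n)).div hden (pow_ne_zero _ h1)), ?_⟩
  simp only [eulerianRatio, hrec, Nat.add_sub_cancel]
  field_simp
  push_cast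
  ring

lemma sum_pow_mul_pow_eq_eulerianRatio (m n : ℕ) {t : ℝ} (ht : t ≠ 1) :
    ∑ i ∈ Finset.Icc 1 m, (i : ℝ) ^ n * t ^ i =
      ∑ l ∈ Finset.range (n + 1),
          (n.choose l : ℝ) * (m : ℝ) ^ l * (t ^ (m + 1) * eulerianRatio (n - l) t)
        - t * eulerianRatio n t := by
  induction n generalizing t with
  | zero =>
    have h1 : t - 1 ≠ 0 := sub_ne_zero.2 ht
    induction m with
    | zero => simp
    | succ m ih =>
      rw [Finset.sum_Icc_succ_top (by omega), ih]
      simp [eulerianRatio, eulerianPoly]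
      field_simp
      ring
  | succ n ih =>
    have hL : HasDerivAt (fun s : ℝ => ∑ i ∈ Finset.Icc 1 m, (i : ℝ) ^ n * s ^ i)
        (∑ i ∈ Finset.Icc 1 m, (i : ℝ) ^ n * (i * t ^ (i - 1))) t :=
      HasDerivAt.fun_sum fun i _ => (hasDerivAt_pow i t).const_mul _
    choose d hd hd' using fun k => hasDerivAt_pow_mul_eulerianRatio m k ht
    obtain ⟨e, he, he'⟩ := hasDerivAt_pow_mul_eulerianRatio 0 n ht
    have hR := (HasDerivAt.fun_sum (u := Finset.range (n + 1)) fun l _ =>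
      (hd (n - l)).const_mul ((n.choose l : ℝ) * (m : ℝ) ^ l)).sub he
    have hLR : HasDerivAt (fun s : ℝ => ∑ i ∈ Finset.Icc 1 m, (i : ℝ) ^ n * s ^ i) _ t :=
      hR.congr_of_eventuallyEq <| (eventually_ne_nhds ht).mono fun s hs => by
        simp only [ih hs, Pi.sub_apply, zero_add, pow_one]
    have hpascal := Finset.sum_choose_succ_mul
      (fun l k => (m : ℝ) ^ l * (t ^ (m + 1) * eulerianRatio k t)) n
    simp only [← mul_assoc] at hpascal ⊢
    rw [hpascal, ← Finset.sum_add_distrib]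
    calc ∑ i ∈ Finset.Icc 1 m, (i : ℝ) ^ (n + 1) * t ^ i
        = t * ∑ i ∈ Finset.Icc 1 m, (i : ℝ) ^ n * (i * t ^ (i - 1)) := by
          rw [Finset.mul_sum]
          refine Finset.sum_congr rfl fun i hi => ?_
          obtain ⟨j, rfl⟩ := Nat.exists_eq_add_of_le' (Finset.mem_Icc.1 hi).1
          rw [Nat.add_sub_cancel]
          ring
      _ = _ := by
          rw [hL.unique hLR, mul_sub, he', Finset.mul_sum]
          congr 1
          · refine Finset.sum_congr rfl fun l hl => ?_
            rw [mul_left_comm, hd', Nat.succ_sub (Finset.mem_range_succ_iff.1 hl)]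
            ring
          · simp

/-- Euler's formula (2): for `m, n ≥ 1` and `t ≠ 1`,
`∑_{i=1}^m i^n t^i = ∑_{l=1}^n (-1)^{n+l} C(n,l) t^{m+1} m^l A_{n-l}(t)/(t-1)^{n-l+1}
  + (-1)^n t (t^m - 1) A_n(t)/(t-1)^{n+1}`. -/
theorem sum_pow_mul_pow_eq (m n : ℕ) (hm : 1 ≤ m) (hn : 1 ≤ n) (t : ℝ) (ht : t ≠ 1) :
    ∑ i ∈ Finset.Icc 1 m, (i : ℝ) ^ n * t ^ i =
      (∑ l ∈ Finset.Icc 1 n, (-1 : ℝ) ^ (n + l) * (n.choose l : ℝ) *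
        (t ^ (m + 1) * (m : ℝ) ^ l / (t - 1) ^ (n - l + 1)) * eulerianPoly (n - l) t)
      + (-1 : ℝ) ^ n * (t * (t ^ m - 1) / (t - 1) ^ (n + 1)) * eulerianPoly n t := by
  rw [sum_pow_mul_pow_eq_eulerianRatio m n ht, Finset.range_eq_Ico,
    Finset.sum_eq_sum_Ico_succ_bot (Nat.succ_pos n), zero_add, Nat.succ_eq_add_one, Finset.Ico_add_one_right_eq_Icc]
  have hl : ∀ l ∈ Finset.Icc 1 n,
      (n.choose l : ℝ) * (m : ℝ) ^ l * (t ^ (m + 1) * eulerianRatio (n - l) t) =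
        (-1 : ℝ) ^ (n + l) * (n.choose l : ℝ) *
          (t ^ (m + 1) * (m : ℝ) ^ l / (t - 1) ^ (n - l + 1)) * eulerianPoly (n - l) t := by
    intro l hl
    have hsign : (-1 : ℝ) ^ (n + l) = (-1) ^ (n - l) := by
      obtain ⟨k, rfl⟩ := Nat.exists_eq_add_of_le (Finset.mem_Icc.1 hl).2
      rw [Nat.add_sub_cancel_left, add_right_comm, pow_add, Even.neg_one_pow ⟨l, rfl⟩, one_mul]
    rw [hsign, eulerianRatio]
    ring
  rw [Finset.sum_congr rfl hl]
  simp only [eulerianRatio, Nat.choose_zero_right, Nat.sub_zero, Nat.cast_one, pow_zero]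
  ring
end

section
/- For all positive integers m, n and every real number t with t ≠ 1, the power sum ∑_{i=1}^m i^n t^i equals -t^{m+1} ∑_{k=0}^{n} C(n, k) m^{n-k} A_k(t) / (1-t)^{k+1} + t A_n(t) / (1-t)^{n+1}, where C denotes the binomial coefficient. -/
open scoped Classical

namespace Eulerian

/-- The one-line notation of a permutation of `Fin n`, extended by zero. -/
def word {n : ℕ} (π : Equiv.Perm (Fin n)) (j : ℕ) : ℕ :=
  if h : j < n then π ⟨j, h⟩ else 0

lemma word_of_lt {n : ℕ} (π : Equiv.Perm (Fin n)) {j : ℕ} (h : j < n) :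
    word π j = π ⟨j, h⟩ := dif_pos h

lemma word_of_le {n : ℕ} (π : Equiv.Perm (Fin n)) {j : ℕ} (h : n ≤ j) : word π j = 0 :=
  dif_neg (by omega)

lemma word_le {n : ℕ} (π : Equiv.Perm (Fin n)) (j : ℕ) : word π j ≤ n := by
  unfold word
  split_ifs <;> omega

lemma word_lt {n : ℕ} (π : Equiv.Perm (Fin n)) {j : ℕ} (h : j < n) : word π j < n := by
  rw [word_of_lt π h]
  omega

lemma ascentCount_eq_sum {n : ℕ} (π : Equiv.Perm (Fin n)) :
    ascentCount π = ∑ j ∈ Finset.range n, if word π j < word π (j + 1) then 1 else 0 := by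
  rw [← Finset.card_filter, ascentCount]
  congr 1
  ext j
  simp only [Finset.mem_filter, Finset.mem_range]
  constructor
  · rintro ⟨-, h, hlt⟩
    rw [word_of_lt π (Nat.lt_of_succ_lt h), word_of_lt π h]
    exact ⟨by omega, hlt⟩
  · rintro ⟨hj, hlt⟩
    by_cases h : j + 1 < n
    · rw [word_of_lt π hj, word_of_lt π h] at hlt
      exact ⟨by omega, h, hlt⟩
    · rw [word_of_le π (not_lt.mp h)] at hlt
      omega

/-- Insert the new largest value at position `p` of a permutation. -/
def insertMax {n : ℕ} (p : Fin (n + 1)) (π : Equiv.Perm (Fin n)) : Equiv.Perm (Fin (n + 1)) :=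
  ((finSuccEquiv' p).trans (Equiv.optionCongr π)).trans (finSuccEquiv' (Fin.last n)).symm

lemma insertMax_self {n : ℕ} (p : Fin (n + 1)) (π : Equiv.Perm (Fin n)) :
    insertMax p π p = Fin.last n := by
  simp [insertMax]

lemma insertMax_succAbove {n : ℕ} (p : Fin (n + 1)) (π : Equiv.Perm (Fin n)) (i : Fin n) :
    insertMax p π (p.succAbove i) = (π i).castSucc := by
  simp [insertMax]

lemma insertMax_bijective (n : ℕ) :
    Function.Bijective fun x : Fin (n + 1) × Equiv.Perm (Fin n) => insertMax x.1 x.2 := by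
  rw [Fintype.bijective_iff_injective_and_card]
  constructor
  · rintro ⟨p, π⟩ ⟨q, ρ⟩ h
    simp only at h
    obtain rfl : p = q := by
      apply (insertMax p π).injective
      rw [insertMax_self, h, insertMax_self]
    congr 1
    ext i : 1
    apply Fin.castSucc_injective
    rw [← insertMax_succAbove p, ← insertMax_succAbove p, h]
  · simp [Fintype.card_perm, Nat.factorial_succ]

lemma word_insertMax_of_lt {n : ℕ} (p : Fin (n + 1)) (π : Equiv.Perm (Fin n)) {j : ℕ}
    (h : j < p) : word (insertMax p π) j = word π j := by
  have hj : j < n := by omega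
  have key : p.succAbove ⟨j, hj⟩ = ⟨j, by omega⟩ :=
    Fin.succAbove_of_castSucc_lt _ _ (by simpa [Fin.lt_def] using h)
  rw [word_of_lt _ (by omega : j < n + 1), word_of_lt _ hj, ← key, insertMax_succAbove]
  rfl

lemma word_insertMax_self {n : ℕ} (p : Fin (n + 1)) (π : Equiv.Perm (Fin n)) :
    word (insertMax p π) p = n := by
  rw [word_of_lt _ p.isLt, Fin.eta, insertMax_self, Fin.val_last]

lemma word_insertMax_succ {n : ℕ} (p : Fin (n + 1)) (π : Equiv.Perm (Fin n)) {j : ℕ}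
    (h : p ≤ j) : word (insertMax p π) (j + 1) = word π j := by
  by_cases hj : j < n
  · have key : p.succAbove ⟨j, hj⟩ = ⟨j + 1, by omega⟩ :=
      Fin.succAbove_of_le_castSucc _ _ (by simpa [Fin.le_def] using h)
    rw [word_of_lt _ (by omega : j + 1 < n + 1), word_of_lt _ hj, ← key, insertMax_succAbove]
    rfl
  · rw [word_of_le _ (by omega), word_of_le _ (by omega)]

lemma ascentCount_insertMax_zero {n : ℕ} (π : Equiv.Perm (Fin n)) :
    ascentCount (insertMax 0 π) = ascentCount π := by
  have h0 : word (insertMax 0 π) 0 = n := word_insertMax_self 0 π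
  have hs (j : ℕ) : word (insertMax 0 π) (j + 1) = word π j :=
    word_insertMax_succ 0 π (Nat.zero_le j)
  rw [ascentCount_eq_sum, ascentCount_eq_sum, Finset.sum_range_succ']
  simp only [hs, h0]
  simp [word_le]

lemma ascentCount_insertMax_succ {n : ℕ} (π : Equiv.Perm (Fin n)) (q : Fin n) :
    ascentCount (insertMax q.succ π) + (if word π q < word π (q + 1) then 1 else 0) =
      ascentCount π + 1 := by
  obtain ⟨q, hq⟩ := q
  obtain ⟨r, rfl⟩ := Nat.exists_eq_add_of_lt hq
  set σ := insertMax (Fin.succ ⟨q, hq⟩) π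
  have hlow {j : ℕ} (h : j < q + 1) : word σ j = word π j := word_insertMax_of_lt _ π h
  have hmax : word σ (q + 1) = q + r + 1 := word_insertMax_self (Fin.succ ⟨q, hq⟩) π
  have hhigh {j : ℕ} (h : q + 1 ≤ j) : word σ (j + 1) = word π j := word_insertMax_succ _ π h
  have hsplit_max := Finset.sum_range_add
    (fun j => if word σ j < word σ (j + 1) then 1 else 0) (q + 1 + 1) r
  rw [Finset.sum_range_succ, Finset.sum_range_succ,
    show q + 1 + 1 + r = q + r + 1 + 1 by ring] at hsplit_max
  have hsplit := Finset.sum_range_add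
    (fun j => if word π j < word π (j + 1) then 1 else 0) (q + 1) r
  rw [Finset.sum_range_succ, show q + 1 + r = q + r + 1 by ring] at hsplit
  have h1 : (∑ j ∈ Finset.range q, if word σ j < word σ (j + 1) then 1 else 0) =
      ∑ j ∈ Finset.range q, if word π j < word π (j + 1) then 1 else 0 := by
    refine Finset.sum_congr rfl fun j hj => ?_
    have := Finset.mem_range.mp hj
    rw [hlow (by omega), hlow (by omega)]
  have h2 : (∑ j ∈ Finset.range r,
        if word σ (q + 1 + 1 + j) < word σ (q + 1 + 1 + j + 1) then 1 else 0) =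
      ∑ j ∈ Finset.range r, if word π (q + 1 + j) < word π (q + 1 + j + 1) then 1 else 0 := by
    refine Finset.sum_congr rfl fun j _ => ?_
    rw [hhigh (by omega), show q + 1 + 1 + j = q + 1 + j + 1 by ring, hhigh (by omega)]
  have h3 : word σ q < word σ (q + 1) := by
    rw [hmax, hlow (by omega)]
    exact word_lt π hq
  have h4 : ¬ word σ (q + 1) < word σ (q + 1 + 1) := by
    rw [hmax, hhigh le_rfl]
    exact not_lt.mpr (word_le π _)
  rw [ascentCount_eq_sum, ascentCount_eq_sum, hsplit_max, h1, h2, if_pos h3, if_neg h4, hsplit]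
  ring

lemma ascentCount_lt {n : ℕ} (hn : n ≠ 0) (π : Equiv.Perm (Fin n)) : ascentCount π < n := by
  have h : ascentCount π ≤ n - 1 := by
    simpa [ascentCount] using Finset.card_filter_le (Finset.range (n - 1)) _
  omega

lemma eulerianPoly_eq_sum_perm (n : ℕ) (t : ℝ) :
    eulerianPoly n t = ∑ π : Equiv.Perm (Fin n), t ^ ascentCount π := by
  unfold eulerianPoly
  split_ifs with hn
  · subst hn
    simp [ascentCount]
  · rw [← Finset.sum_fiberwise_of_maps_to
      (fun π _ => Finset.mem_range.mpr (ascentCount_lt hn π))]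
    refine Finset.sum_congr rfl fun k _ => ?_
    rw [Finset.sum_congr rfl fun π hπ => by rw [(Finset.mem_filter.mp hπ).2]]
    simp [eulerian]

lemma sum_pow_ascentCount_insertMax {n : ℕ} (π : Equiv.Perm (Fin n)) (t : ℝ) :
    ∑ p, t ^ ascentCount (insertMax p π) =
      t ^ ascentCount π * (1 + ascentCount π + (n - ascentCount π) * t) := by
  have hstep (q : Fin n) : t ^ ascentCount (insertMax q.succ π) = t ^ ascentCount π *
      (t + (1 - t) * ((if word π q < word π (q + 1) then 1 else 0 : ℕ) : ℝ)) := by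
    have h := ascentCount_insertMax_succ π q
    split_ifs at h ⊢
    · rw [Nat.add_right_cancel h]
      simp
    · rw [add_zero] at h
      rw [h, pow_succ]
      simp
  rw [Fin.sum_univ_succ, ascentCount_insertMax_zero, Finset.sum_congr rfl fun q _ => hstep q,
    ← Finset.mul_sum, Finset.sum_add_distrib, ← Finset.mul_sum, ← Nat.cast_sum,
    Fin.sum_univ_eq_sum_range (fun j => if word π j < word π (j + 1) then 1 else 0),
    ← ascentCount_eq_sum]
  simp
  ring

lemma eulerianPoly_succ (n : ℕ) (t : ℝ) :
    eulerianPoly (n + 1) t = ∑ π : Equiv.Perm (Fin n),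
      t ^ ascentCount π * (1 + ascentCount π + (n - ascentCount π) * t) := by
  rw [eulerianPoly_eq_sum_perm, ← (insertMax_bijective n).sum_comp, Fintype.sum_prod_type_right]
  exact Finset.sum_congr rfl fun π _ => sum_pow_ascentCount_insertMax π t

lemma hasDerivAt_eulerianPoly (n : ℕ) (t : ℝ) :
    ∃ d, HasDerivAt (eulerianPoly n) d t ∧
      eulerianPoly (n + 1) t = (1 + n * t) * eulerianPoly n t + t * (1 - t) * d := by
  refine ⟨∑ π : Equiv.Perm (Fin n), ascentCount π * t ^ (ascentCount π - 1), ?_, ?_⟩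
  · rw [funext (eulerianPoly_eq_sum_perm n)]
    exact HasDerivAt.fun_sum fun π _ => hasDerivAt_pow _ t
  · rw [eulerianPoly_succ, eulerianPoly_eq_sum_perm, Finset.mul_sum, Finset.mul_sum,
      ← Finset.sum_add_distrib]
    refine Finset.sum_congr rfl fun π _ => ?_
    rcases ascentCount π with _ | a
    · simp
    · simp only [Nat.add_sub_cancel, pow_succ]
      push_cast
      ring

/-- The rational function that agrees with `∑ i ≥ 1, i ^ n * t ^ i` for `|t| < 1`. -/
noncomputable def powSeries (n : ℕ) (t : ℝ) : ℝ :=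
  t * eulerianPoly n t / (1 - t) ^ (n + 1)

lemma hasDerivAt_powSeries (n : ℕ) {t : ℝ} (ht : t ≠ 1) :
    ∃ d, HasDerivAt (powSeries n) d t ∧ t * d = powSeries (n + 1) t := by
  obtain ⟨d, hd, hrec⟩ := hasDerivAt_eulerianPoly n t
  have h1 : 1 - t ≠ 0 := sub_ne_zero.mpr ht.symm
  have hden : HasDerivAt (fun x : ℝ => (1 - x) ^ (n + 1)) _ t :=
    ((hasDerivAt_id t).const_sub 1).pow (n + 1)
  refine ⟨_, ((hasDerivAt_id t).mul hd).div hden (pow_ne_zero _ h1), ?_⟩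
  rw [powSeries, hrec]
  simp only [id, Pi.mul_apply, Nat.add_sub_cancel]
  push_cast
  field_simp
  ring

lemma sum_choose_succ (n : ℕ) (x : ℝ) (f : ℕ → ℝ) :
    ∑ k ∈ Finset.range (n + 2), ((n + 1).choose k : ℝ) * x ^ (n + 1 - k) * f k =
      x * ∑ k ∈ Finset.range (n + 1), (n.choose k : ℝ) * x ^ (n - k) * f k +
        ∑ k ∈ Finset.range (n + 1), (n.choose k : ℝ) * x ^ (n - k) * f (k + 1) := by
  have hx : x * ∑ k ∈ Finset.range (n + 1), (n.choose k : ℝ) * x ^ (n - k) * f k =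
      ∑ k ∈ Finset.range (n + 2), (n.choose k : ℝ) * x ^ (n + 1 - k) * f k := by
    rw [Finset.sum_range_succ _ (n + 1), Nat.choose_succ_self, Finset.mul_sum]
    simp only [Nat.cast_zero, zero_mul, add_zero]
    refine Finset.sum_congr rfl fun k hk => ?_
    rw [Nat.succ_sub (Nat.lt_succ_iff.mp (Finset.mem_range.mp hk)), pow_succ]
    ring
  rw [hx, Finset.sum_range_succ' _ (n + 1), Finset.sum_range_succ' _ (n + 1),
    add_right_comm, ← Finset.sum_add_distrib]
  simp only [Nat.choose_zero_right, Nat.choose_succ_succ', Nat.add_sub_add_right]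
  congr 1
  refine Finset.sum_congr rfl fun k _ => ?_
  push_cast
  ring

lemma sum_pow_mul_pow_eq_powSeries (m n : ℕ) {t : ℝ} (ht : t ≠ 1) :
    ∑ i ∈ Finset.Icc 1 m, (i : ℝ) ^ n * t ^ i =
      powSeries n t - t ^ m * ∑ k ∈ Finset.range (n + 1),
        (n.choose k : ℝ) * (m : ℝ) ^ (n - k) * powSeries k t := by
  induction n generalizing t with
  | zero =>
    have h1 : 1 - t ≠ 0 := sub_ne_zero.mpr ht.symm
    simp only [pow_zero, one_mul, powSeries, eulerianPoly, zero_add, Finset.range_one,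
      Finset.sum_singleton, Nat.choose_self, Nat.cast_one, if_true, mul_one, pow_one, Nat.sub_self]
    induction m with
    | zero => simp
    | succ m ih =>
      rw [Finset.sum_Icc_succ_top (by omega), ih]
      field_simp
      ring
  | succ n ih =>
    choose d hd hrec using fun k => hasDerivAt_powSeries k ht
    have hL : HasDerivAt (fun x : ℝ => ∑ i ∈ Finset.Icc 1 m, (i : ℝ) ^ n * x ^ i) _ t :=
      HasDerivAt.fun_sum fun i _ => (hasDerivAt_pow i t).const_mul ((i : ℝ) ^ n)
    have hS : HasDerivAt (fun x : ℝ => ∑ k ∈ Finset.range (n + 1),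
        (n.choose k : ℝ) * (m : ℝ) ^ (n - k) * powSeries k x) _ t :=
      HasDerivAt.fun_sum fun k _ => (hd k).const_mul _
    have hR := (hd n).fun_sub ((hasDerivAt_pow m t).fun_mul hS)
    have hev := (eventually_ne_nhds ht).mono fun x hx => ih hx
    have key := congrArg (t * ·) (hL.unique (hR.congr_of_eventuallyEq hev))
    have hpow (i : ℕ) : t * (i * t ^ (i - 1)) = i * t ^ i := by
      rcases i with _ | i
      · simp
      · rw [Nat.add_sub_cancel, pow_succ]
        ring
    have hleft : t * ∑ i ∈ Finset.Icc 1 m, (i : ℝ) ^ n * (i * t ^ (i - 1)) =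
        ∑ i ∈ Finset.Icc 1 m, (i : ℝ) ^ (n + 1) * t ^ i := by
      rw [Finset.mul_sum]
      refine Finset.sum_congr rfl fun i _ => ?_
      rw [mul_left_comm, hpow, pow_succ]
      ring
    have hsum : t * ∑ k ∈ Finset.range (n + 1), (n.choose k : ℝ) * (m : ℝ) ^ (n - k) * d k =
        ∑ k ∈ Finset.range (n + 1),
          (n.choose k : ℝ) * (m : ℝ) ^ (n - k) * powSeries (k + 1) t := by
      rw [Finset.mul_sum]
      refine Finset.sum_congr rfl fun k _ => ?_
      rw [mul_left_comm, hrec]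
    rw [hleft] at key
    rw [key, sum_choose_succ, ← hsum, ← hrec n, mul_sub, mul_add, ← mul_assoc t, hpow]
    ring

end Eulerian

/-- Euler's formula (3): for `m, n ≥ 1` and `t ≠ 1`,
`∑_{i=1}^m i^n t^i = -t^{m+1} ∑_{k=0}^n C(n,k) m^{n-k} A_k(t)/(1-t)^{k+1}
  + t A_n(t)/(1-t)^{n+1}`. -/
theorem sum_pow_mul_pow_eq' (m n : ℕ) (hm : 1 ≤ m) (hn : 1 ≤ n) (t : ℝ) (ht : t ≠ 1) :
    ∑ i ∈ Finset.Icc 1 m, (i : ℝ) ^ n * t ^ i =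
      -t ^ (m + 1) * (∑ k ∈ Finset.range (n + 1), (n.choose k : ℝ) *
        ((m : ℝ) ^ (n - k) / (1 - t) ^ (k + 1)) * eulerianPoly k t)
      + t * eulerianPoly n t / (1 - t) ^ (n + 1) := by
  rw [Eulerian.sum_pow_mul_pow_eq_powSeries m n ht, Finset.mul_sum, Finset.mul_sum,
    sub_eq_neg_add, ← Finset.sum_neg_distrib]
  simp only [Eulerian.powSeries]
  congr 1
  refine Finset.sum_congr rfl fun k _ => ?_
  ring
end

section
/- Let a, d be real numbers. For all real t and u with t ≠ 1 and t ≠ exp(du(t-1)), the exponential generating function of the general Eulerian polynomials satisfies ∑_{n≥0} T_n(t,a,d) u^n / n! = (t-1) exp(au(t-1)) / (t - exp(du(t-1))), the series converging for |u| sufficiently small. -/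
/-- General Eulerian numbers `A_{n,k}(a,d)` for the arithmetic progression
`a, a+d, a+2d, …`: `A_{0,-1}(a,d) = 1`, `A_{n,k}(a,d) = 0` for `k ≥ n` or `k ≤ -2`, and
`A_{n,k}(a,d) = (-a+(k+2)d) A_{n-1,k}(a,d) + (a+(n-k-1)d) A_{n-1,k-1}(a,d)` for `n ≥ 1`. -/
noncomputable def genEulerian (a d : ℝ) : ℕ → ℤ → ℝ
  | 0, k => if k = -1 then 1 else 0
  | (n + 1), k =>
      if ((n : ℤ) + 1 ≤ k ∨ k ≤ -2) then 0
      else (-a + ((k : ℝ) + 2) * d) * genEulerian a d n k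
        + (a + (((n : ℝ) + 1) - (k : ℝ) - 1) * d) * genEulerian a d n (k - 1)

/-- General Eulerian polynomial `T_n(t,a,d) = ∑_{k=-1}^{n-1} A_{n,k}(a,d) t^{k+1}`
(which equals `1` when `n = 0`). -/
noncomputable def genEulerianPoly (n : ℕ) (t a d : ℝ) : ℝ :=
  ∑ k ∈ Finset.range (n + 1), genEulerian a d n ((k : ℤ) - 1) * t ^ k

/-- Coefficient form of the recurrence, indexed from `0`. -/
theorem genEulerian_succ_sub_one (a d : ℝ) (n k : ℕ) (hk : k ≤ n + 1) :
    genEulerian a d (n + 1) ((k : ℤ) - 1) =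
      (-a + ((k : ℝ) + 1) * d) * genEulerian a d n ((k : ℤ) - 1)
        + (a + ((n : ℝ) + 1 - k) * d) * genEulerian a d n ((k : ℤ) - 2) := by
  rw [genEulerian, if_neg (by omega), show (k : ℤ) - 1 - 1 = k - 2 by ring]
  push_cast
  ring

theorem genEulerian_eq_zero_of_le (a d : ℝ) (n : ℕ) (k : ℤ) (hk : (n : ℤ) ≤ k) :
    genEulerian a d n k = 0 := by
  cases n with
  | zero => rw [genEulerian, if_neg (by omega)]
  | succ n => rw [genEulerian, if_pos (by omega)]

theorem genEulerian_neg_two (a d : ℝ) (n : ℕ) : genEulerian a d n (-2) = 0 := by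
  cases n with
  | zero => rw [genEulerian, if_neg (by omega)]
  | succ n => rw [genEulerian, if_pos (by omega)]

/-- The general Eulerian polynomial, homogenized to degree `n` in `x` and `y`. -/
noncomputable def genEulerianHom (a d : ℝ) (n : ℕ) (x y : ℝ) : ℝ :=
  ∑ k ∈ Finset.range (n + 1), genEulerian a d n ((k : ℤ) - 1) * x ^ k * y ^ (n - k)

/-- The Euler derivative `y ∂/∂y` of `genEulerianHom`. -/
noncomputable def genEulerianHomEuler (a d : ℝ) (n : ℕ) (x y : ℝ) : ℝ :=
  ∑ k ∈ Finset.range (n + 1),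
    genEulerian a d n ((k : ℤ) - 1) * x ^ k * (((n - k : ℕ) : ℝ) * y ^ (n - k))

theorem genEulerianHom_zero (a d x y : ℝ) : genEulerianHom a d 0 x y = 1 := by
  simp [genEulerianHom, genEulerian]

theorem genEulerianHom_one_right (a d : ℝ) (n : ℕ) (t : ℝ) :
    genEulerianHom a d n t 1 = genEulerianPoly n t a d := by
  simp [genEulerianHom, genEulerianPoly]

theorem genEulerianHom_succ (a d : ℝ) (n : ℕ) (x y : ℝ) :
    genEulerianHom a d (n + 1) x y =
      (a * genEulerianHom a d n x y + d * genEulerianHomEuler a d n x y) * (x - y)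
        + (n + 1) * d * y * genEulerianHom a d n x y := by
  have split : genEulerianHom a d (n + 1) x y =
      (∑ k ∈ Finset.range (n + 2), (-a + ((k : ℝ) + 1) * d) *
          genEulerian a d n ((k : ℤ) - 1) * x ^ k * y ^ (n + 1 - k))
        + ∑ k ∈ Finset.range (n + 2), (a + ((n : ℝ) + 1 - k) * d) *
          genEulerian a d n ((k : ℤ) - 2) * x ^ k * y ^ (n + 1 - k) := by
    rw [genEulerianHom, ← Finset.sum_add_distrib]
    refine Finset.sum_congr rfl fun k hk => ?_
    rw [genEulerian_succ_sub_one a d n k (by simp at hk; omega)]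
    ring
  rw [split, Finset.sum_range_succ, genEulerian_eq_zero_of_le a d n _ (by push_cast; omega),
    Finset.sum_range_succ' _ (n + 1)]
  simp only [Nat.cast_zero, zero_sub, genEulerian_neg_two, mul_zero, zero_mul, add_zero]
  rw [genEulerianHom, genEulerianHomEuler, ← Finset.sum_add_distrib, Finset.mul_sum,
    Finset.mul_sum, Finset.mul_sum, ← Finset.sum_add_distrib, Finset.sum_mul,
    ← Finset.sum_add_distrib]
  refine Finset.sum_congr rfl fun k hk => ?_
  obtain ⟨m, rfl⟩ : ∃ m, n = k + m := Nat.exists_eq_add_of_le (by simp at hk; omega)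
  rw [show k + m + 1 - k = m + 1 by omega, show k + m + 1 - (k + 1) = m by omega,
    show k + m - k = m by omega, show ((k + 1 : ℕ) : ℤ) - 2 = k - 1 by push_cast; ring]
  push_cast
  ring

theorem hasDerivAt_genEulerianHom (a d : ℝ) (n : ℕ) (x c u : ℝ) :
    HasDerivAt (fun v => genEulerianHom a d n x (Real.exp (c * v)))
      (c * genEulerianHomEuler a d n x (Real.exp (c * u))) u := by
  unfold genEulerianHom genEulerianHomEuler
  simp_rw [Finset.mul_sum, ← Real.exp_nat_mul]
  refine HasDerivAt.fun_sum fun k _ => ?_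
  have h := ((((hasDerivAt_id u).const_mul c).const_mul ((n - k : ℕ) : ℝ)).exp).const_mul
    (genEulerian a d n ((k : ℤ) - 1) * x ^ k)
  refine h.congr_deriv ?_
  simp only [id]
  ring

/-- The `n`-th derivative in `u` of the closed form of the generating function. -/
noncomputable def genEulerianEgfDeriv (a d t : ℝ) (n : ℕ) (u : ℝ) : ℝ :=
  (t - 1) ^ (n + 1) * Real.exp (a * (t - 1) * u) *
    genEulerianHom a d n t (Real.exp (d * (t - 1) * u)) /
      (t - Real.exp (d * (t - 1) * u)) ^ (n + 1)

theorem genEulerianEgfDeriv_zero_right (a d t : ℝ) (ht : t ≠ 1) (n : ℕ) :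
    genEulerianEgfDeriv a d t n 0 = genEulerianPoly n t a d := by
  have : (t - 1) ^ (n + 1) ≠ 0 := pow_ne_zero _ (sub_ne_zero.2 ht)
  simp only [genEulerianEgfDeriv, mul_zero, Real.exp_zero, genEulerianHom_one_right, mul_one]
  field_simp

theorem hasDerivAt_genEulerianEgfDeriv (a d t : ℝ) (n : ℕ) (u : ℝ)
    (hu : t - Real.exp (d * (t - 1) * u) ≠ 0) :
    HasDerivAt (genEulerianEgfDeriv a d t n) (genEulerianEgfDeriv a d t (n + 1) u) u := by
  have exp_deriv (c : ℝ) : HasDerivAt (fun v => Real.exp (c * v)) (c * Real.exp (c * u)) u := by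
    simpa [mul_comm] using ((hasDerivAt_id u).const_mul c).exp
  have h := ((((exp_deriv (a * (t - 1))).const_mul ((t - 1) ^ (n + 1))).mul
    (hasDerivAt_genEulerianHom a d n t (d * (t - 1)) u)).div
      (((exp_deriv (d * (t - 1))).const_sub t).pow (n + 1)) (pow_ne_zero _ hu))
  refine h.congr_deriv ?_
  simp only [genEulerianEgfDeriv, genEulerianHom_succ, Pi.mul_apply, Pi.pow_apply]
  rw [div_eq_div_iff (pow_ne_zero _ (pow_ne_zero _ hu)) (pow_ne_zero _ hu), Nat.add_sub_cancel]
  generalize t - Real.exp (d * (t - 1) * u) = z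
  push_cast
  ring

theorem iteratedDeriv_genEulerianEgfDeriv (a d t : ℝ) (ht : t ≠ 1) (n : ℕ) :
    iteratedDeriv n (genEulerianEgfDeriv a d t 0) =ᶠ[nhds 0] genEulerianEgfDeriv a d t n := by
  induction n with
  | zero => simp
  | succ n ih =>
    have hne : ∀ᶠ u in nhds (0 : ℝ), t - Real.exp (d * (t - 1) * u) ≠ 0 := by
      refine ContinuousAt.eventually_ne (by fun_prop) ?_
      simpa [sub_eq_zero] using ht
    rw [iteratedDeriv_succ]
    refine ih.deriv.trans ?_
    filter_upwards [hne] with u hu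
    exact (hasDerivAt_genEulerianEgfDeriv a d t n u hu).deriv

theorem analyticAt_genEulerianEgfDeriv_zero (a d t : ℝ) (ht : t ≠ 1) :
    AnalyticAt ℝ (genEulerianEgfDeriv a d t 0) 0 := by
  unfold genEulerianEgfDeriv
  simp only [genEulerianHom_zero]
  refine AnalyticAt.fun_div (by fun_prop) (by fun_prop) ?_
  simpa [sub_eq_zero] using ht

/-- Exponential generating function of the general Eulerian polynomials: for `t ≠ 1`
and all sufficiently small `u` with `t ≠ exp(du(t-1))`, the series
`∑_{n≥0} T_n(t,a,d) u^n/n!` converges to `(t-1) exp(au(t-1)) / (t - exp(du(t-1)))`. -/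
theorem genEulerianPoly_egf (a d : ℝ) (t : ℝ) (ht : t ≠ 1) :
    ∃ ε > 0, ∀ u : ℝ, |u| < ε → t ≠ Real.exp (d * u * (t - 1)) →
      HasSum (fun n : ℕ => genEulerianPoly n t a d * u ^ n / (n.factorial : ℝ))
        ((t - 1) * Real.exp (a * u * (t - 1)) / (t - Real.exp (d * u * (t - 1)))) := by
  obtain ⟨r, hr⟩ := (analyticAt_genEulerianEgfDeriv_zero a d t ht).hasFPowerSeriesAt
  obtain ⟨ε, hε, hεr⟩ := ENNReal.lt_iff_exists_nnreal_btwn.1 hr.r_pos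
  refine ⟨ε, by exact_mod_cast hε, fun u hu _ => ?_⟩
  have hmem : u ∈ Metric.eball (0 : ℝ) r := by
    refine Metric.eball_subset_eball hεr.le ?_
    rw [Metric.eball_coe]
    simpa using hu
  convert! hr.hasSum hmem using 1
  · funext n
    simp only [FormalMultilinearSeries.ofScalars_apply_eq, smul_eq_mul,
      (iteratedDeriv_genEulerianEgfDeriv a d t ht n).eq_of_nhds,
      genEulerianEgfDeriv_zero_right a d t ht n]
    ring
  · simp only [genEulerianEgfDeriv, genEulerianHom_zero, zero_add, pow_one, mul_one]
    simp only [mul_right_comm]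
end
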